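/- arXiv:2406.10631 — 2 statements merged into one kernel-verified Lean document; each statement's English description precedes it below -/
import Mathlib

section
/- Suppose the regularizer R : [0,1] → ℝ satisfies the standard assumption with Lipschitz constant L > 0 and the main assumption with constants c1, δ', c2, c3. Then for every δ with 0 < δ < min{1/15, c1/6, c1²/300, δ'} and every step size η with 0 < η ≤ 1/(4L), the OFTRL dynamics with regularizer R and step size η on the game A_δ admits an iteration t with t ≥ c1/(3ηLδ) and DualGap(x^t, y^t) ≥ c2. -/
open Set Matrix Filter

noncomputable section

/-- The 2×2 loss matrix `A_δ` with first row `(1/2+δ, 1/2)` and second row `(0, 1)`. -/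
def Adelta (δ : ℝ) : Matrix (Fin 2) (Fin 2) ℝ := !![1/2 + δ, 1/2; 0, 1]

/-- The duality gap `max_{y'∈Δ²} xᵀ A y' − min_{x'∈Δ²} x'ᵀ A y`. -/
def dualGap (A : Matrix (Fin 2) (Fin 2) ℝ) (x y : Fin 2 → ℝ) : ℝ :=
  sSup ((fun y' => x ⬝ᵥ A.mulVec y') '' stdSimplex ℝ (Fin 2)) -
  sInf ((fun x' => x' ⬝ᵥ A.mulVec y) '' stdSimplex ℝ (Fin 2))

/-- `e_x^t = ℓ_x^t[1] − ℓ_x^t[2]` where `ℓ_x^t = A y^t` (and `e_x^0 = 0`). -/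
def exSeq (A : Matrix (Fin 2) (Fin 2) ℝ) (y : ℕ → Fin 2 → ℝ) (t : ℕ) : ℝ :=
  if t = 0 then 0 else A.mulVec (y t) 0 - A.mulVec (y t) 1

/-- `e_y^t = ℓ_y^t[1] − ℓ_y^t[2]` where `ℓ_y^t = −Aᵀ x^t` (and `e_y^0 = 0`). -/
def eySeq (A : Matrix (Fin 2) (Fin 2) ℝ) (x : ℕ → Fin 2 → ℝ) (t : ℕ) : ℝ :=
  if t = 0 then 0 else (-(Aᵀ.mulVec (x t))) 0 - (-(Aᵀ.mulVec (x t))) 1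

/-- `E^t = Σ_{k=1}^{t} e^k` (since `e 0 = 0`, summing over `range (t+1)` is the same). -/
def cumSum (e : ℕ → ℝ) (t : ℕ) : ℝ := ∑ k ∈ Finset.range (t + 1), e k

/-- The OFTRL dynamics on a 2×2 zero-sum game `A` with response function `F = F_{η,R}`:
for every `t ≥ 1`, `x^t = (F(E_x^{t−1} + e_x^{t−1}), 1 − …)` and similarly for `y^t`. -/
def IsOFTRL2 (F : ℝ → ℝ) (A : Matrix (Fin 2) (Fin 2) ℝ)
    (x y : ℕ → Fin 2 → ℝ) : Prop :=
  ∀ t : ℕ, 1 ≤ t →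
    x t 0 = F (cumSum (exSeq A y) (t - 1) + exSeq A y (t - 1)) ∧
    x t 1 = 1 - x t 0 ∧
    y t 0 = F (cumSum (eySeq A x) (t - 1) + eySeq A x (t - 1)) ∧
    y t 1 = 1 - y t 0

lemma F_anti (R F1 : ℝ → ℝ)
    (hF1 : ∀ e : ℝ, F1 e ∈ Set.Icc (0 : ℝ) 1 ∧ ∀ z ∈ Set.Icc (0 : ℝ) 1, z ≠ F1 e →
      F1 e * e + R (F1 e) < z * e + R z) : Antitone F1 := by
  intro a b hab
  by_contra hlt
  push Not at hlt
  have h1 := (hF1 a).2 (F1 b) (hF1 b).1 hlt.ne'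
  have h2 := (hF1 b).2 (F1 a) (hF1 a).1 hlt.ne
  nlinarith

lemma F_scale (R F1 Fη : ℝ → ℝ) (η : ℝ) (hη : 0 < η)
    (hF1 : ∀ e : ℝ, F1 e ∈ Set.Icc (0 : ℝ) 1 ∧ ∀ z ∈ Set.Icc (0 : ℝ) 1, z ≠ F1 e →
      F1 e * e + R (F1 e) < z * e + R z)
    (hFη : ∀ e : ℝ, Fη e ∈ Set.Icc (0 : ℝ) 1 ∧ ∀ z ∈ Set.Icc (0 : ℝ) 1, z ≠ Fη e →
      Fη e * e + (1 / η) * R (Fη e) < z * e + (1 / η) * R z) (e : ℝ) :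
    Fη e = F1 (η * e) := by
  by_contra hne
  have h1 := (hF1 (η * e)).2 (Fη e) (hFη e).1 hne
  have h2 := (hFη e).2 (F1 (η * e)) (hF1 _).1 (Ne.symm hne)
  have h3 := mul_lt_mul_of_pos_left h2 hη
  have e1 : ∀ z r : ℝ, η * (z * e + 1 / η * r) = z * (η * e) + r := by
    intro z r; field_simp
  rw [e1, e1] at h3
  linarith

set_option maxHeartbeats 4000000 in
/-- The scalar dynamics reach a `y`-iterate above `1/2 + c2` late. -/
lemma core (η L c1 c2 c3 δ' δ : ℝ) (F1 : ℝ → ℝ)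
    (hL : 0 < L) (hη : 0 < η) (hη' : η ≤ 1 / (4 * L))
    (hF01 : ∀ e, F1 e ∈ Set.Icc (0 : ℝ) 1) (hanti : Antitone F1)
    (hstd1 : F1 0 = 1 / 2)
    (hstd2 : Tendsto F1 atBot (nhds 1))
    (hstd4 : ∀ a b : ℝ, |F1 a - F1 b| ≤ L * |a - b|)
    (hc1 : c1 = 1 / 2 - F1 (1 / (20 * L)))
    (hc3 : c3 ∈ Set.Ioc (0 : ℝ) (1 / 2))
    (hmain1 : ∀ d : ℝ, 0 < d → d ≤ δ' → ∀ E : ℝ, 1 / (1 + d) ≤ F1 E →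
      (1 + c3) / (1 + c3 + d) ≤ F1 (E - c1 ^ 2 / (30 * L * d)))
    (hmain2 : ∀ d : ℝ, 0 < d → d ≤ δ' → ∀ E : ℝ, 1 / (2 * (1 + d)) ≤ F1 E →
      1 / 2 + c2 ≤ F1 (E - c3 * c1 ^ 2 / (120 * L) + d / (4 * L)))
    (hδ : 0 < δ) (hδ1 : δ < 1 / 15) (hδ2 : δ < c1 / 6) (hδ3 : δ < c1 ^ 2 / 300)
    (hδ4 : δ < δ')
    (p q a b A B : ℕ → ℝ)
    (ha0 : a 0 = 0) (hb0 : b 0 = 0) (hA0 : A 0 = 0) (hB0 : B 0 = 0)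
    (hA : ∀ t, A (t + 1) = A t + a (t + 1)) (hB : ∀ t, B (t + 1) = B t + b (t + 1))
    (ha : ∀ t, a (t + 1) = (1 + δ) * q (t + 1) - 1 / 2)
    (hb : ∀ t, b (t + 1) = 1 - (1 + δ) * p (t + 1))
    (hp : ∀ t, p (t + 1) = F1 (η * (A t + a t)))
    (hq : ∀ t, q (t + 1) = F1 (η * (B t + b t))) :
    ∃ t : ℕ, c1 / (3 * η * L * δ) ≤ ((t + 1 : ℕ) : ℝ) ∧ 1 / 2 + c2 ≤ q (t + 1) := by
  obtain ⟨hc3p, hc3h⟩ := hc3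
  set h := η * L with hh
  have hhp : 0 < h := by positivity
  have hh4 : h ≤ 1 / 4 := by
    have := mul_le_mul_of_nonneg_right hη' hL.le
    have e : 1 / (4 * L) * L = 1 / 4 := by field_simp
    linarith
  have hc1p : 0 < c1 := by linarith
  have hc120 : c1 ≤ 1 / 20 := by
    have h1 := hstd4 0 (1 / (20 * L))
    have e : L * |0 - 1 / (20 * L)| = 1 / 20 := by
      rw [zero_sub, abs_neg, abs_of_pos (by positivity)]; field_simp
    rw [e, hstd1] at h1
    have := (abs_le.1 h1).2
    linarith
  -- bounds
  have hal : ∀ t, -(1 / 2) ≤ a t := by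
    intro t
    cases t with
    | zero => rw [ha0]; norm_num
    | succ t =>
      rw [ha, hq]
      have := mul_nonneg (by linarith : (0 : ℝ) ≤ 1 + δ) (hF01 (η * (B t + b t))).1
      linarith
  have hau : ∀ t, a t ≤ 1 / 2 + δ := by
    intro t
    cases t with
    | zero => rw [ha0]; linarith
    | succ t =>
      rw [ha, hq]
      have := mul_le_mul_of_nonneg_left (hF01 (η * (B t + b t))).2 (by linarith : (0 : ℝ) ≤ 1 + δ)
      linarith
  have hbl : ∀ t, -δ ≤ b t := by
    intro t
    cases t with
    | zero => rw [hb0]; linarith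
    | succ t =>
      rw [hb, hp]
      have := mul_le_mul_of_nonneg_left (hF01 (η * (A t + a t))).2 (by linarith : (0 : ℝ) ≤ 1 + δ)
      linarith
  have hAl : ∀ t : ℕ, -((t : ℝ) / 2) ≤ A t := by
    intro t
    induction t with
    | zero => rw [hA0]; norm_num
    | succ t ih => rw [hA]; have := hal (t + 1); push_cast; linarith
  have hpu : ∀ t : ℕ, p (t + 1) ≤ 1 / 2 + h * ((t : ℝ) + 1) / 2 := by
    intro t
    rw [hp]
    have hz : -(η * (((t : ℝ) + 1) / 2)) ≤ η * (A t + a t) := by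
      have : -(((t : ℝ) + 1) / 2) ≤ A t + a t := by linarith [hAl t, hal t]
      nlinarith
    have h1 := hanti hz
    have h2 := hstd4 (-(η * (((t : ℝ) + 1) / 2))) 0
    rw [sub_zero, abs_neg, abs_of_nonneg (by positivity : 0 ≤ η * (((t : ℝ) + 1) / 2)), hstd1] at h2
    have h3 := (abs_le.1 h2).2
    have e : L * (η * (((t : ℝ) + 1) / 2)) = h * ((t : ℝ) + 1) / 2 := by rw [hh]; ring
    linarith
  have hBl : ∀ t : ℕ, (1 - δ) * t / 2 - (1 + δ) * h * (t * (t + 1)) / 4 ≤ B t := by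
    intro t
    induction t with
    | zero => rw [hB0]; norm_num
    | succ t ih =>
      rw [hB, hb]
      have := mul_le_mul_of_nonneg_left (hpu t) (by linarith : (0 : ℝ) ≤ 1 + δ)
      push_cast
      nlinarith
  -- N
  obtain ⟨N, hN1, hN2⟩ : ∃ N : ℕ, 1 / 2 ≤ h * N ∧ h * N ≤ 3 / 4 := by
    refine ⟨⌈1 / (2 * h)⌉₊, ?_, ?_⟩
    · have := Nat.le_ceil (1 / (2 * h))
      have := mul_le_mul_of_nonneg_left this hhp.le
      have e : h * (1 / (2 * h)) = 1 / 2 := by field_simp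
      linarith
    · have := (Nat.ceil_lt_add_one (by positivity : 0 ≤ 1 / (2 * h))).le
      have := mul_le_mul_of_nonneg_left this hhp.le
      have e : h * (1 / (2 * h) + 1) = 1 / 2 + h := by field_simp
      linarith
  have hBN : 13 / 100 ≤ h * B N := by
    have h1 := mul_le_mul_of_nonneg_left (hBl N) hhp.le
    set s := h * N with hs
    have e : h * ((1 - δ) * N / 2 - (1 + δ) * h * (N * (N + 1)) / 4)
        = (1 - δ) * s / 2 - (1 + δ) * (s * (s + h)) / 4 := by rw [hs]; ring
    rw [e] at h1
    have h2 : s * (s + h) ≤ s * (s + 1 / 4) :=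
      mul_le_mul_of_nonneg_left (by linarith) (by linarith)
    have h3 : (1 + δ) * (s * (s + h)) ≤ 16 / 15 * (s * (s + 1 / 4)) :=
      mul_le_mul (by linarith) h2 (mul_nonneg (by linarith) (by linarith)) (by norm_num)
    have h4 : 14 / 15 * s ≤ (1 - δ) * s :=
      mul_le_mul_of_nonneg_right (by linarith) (by linarith)
    have h5 : 0 ≤ (s - 1 / 2) * (3 / 4 - s) := mul_nonneg (by linarith) (by linarith)
    have h6 : (s - 1 / 2) * (3 / 4 - s) = 5 / 4 * s - s ^ 2 - 3 / 8 := by ring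
    have h7 : s * (s + 1 / 4) = s ^ 2 + s / 4 := by ring
    linarith
  have hbN : ∀ t, t + 1 ≤ N → (1 + δ) * p (t + 1) < 1 := by
    intro t ht
    have h1 := hpu t
    have h2 : ((t : ℝ) + 1) ≤ N := by exact_mod_cast ht
    have h3 := mul_le_mul_of_nonneg_left h2 hhp.le
    have h4 : p (t + 1) ≤ 7 / 8 := by linarith
    have h5 := mul_le_mul_of_nonneg_left h4 (by linarith : (0 : ℝ) ≤ 1 + δ)
    linarith
  -- q small when B large
  have hqs : ∀ t, 1 / 20 ≤ h * (B t + b t) → a (t + 1) ≤ -(11 / 12 * c1) := by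
    intro t ht
    have h1 : 1 / (20 * L) ≤ η * (B t + b t) := by
      rw [div_le_iff₀ (by positivity)]
      have : η * (B t + b t) * (20 * L) = 20 * (h * (B t + b t)) := by rw [hh]; ring
      linarith
    have h2 := hanti h1
    rw [← hq] at h2
    rw [ha]
    have h3 : q (t + 1) ≤ 1 / 2 - c1 := by linarith
    have h4 := mul_le_mul_of_nonneg_left h3 (by linarith : (0 : ℝ) ≤ 1 + δ)
    have h5 : 0 < δ * c1 := by positivity
    linarith
  -- monotone growth of B while p is small
  have hBmono : ∀ T, (∀ t, N ≤ t → t < T → (1 + δ) * p (t + 1) < 1) →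
      ∀ t, N ≤ t → t ≤ T → B N ≤ B t := by
    intro T hT t hNt
    induction t, hNt using Nat.le_induction with
    | base => intro _; exact le_rfl
    | succ t hNt ih =>
      intro htT
      have := ih (by omega)
      have h2 := hT t hNt (by omega)
      rw [hB, hb]; linarith
  have hev : ∀ r : ℝ, r < 1 → ∃ Z : ℝ, ∀ z ≤ Z, r < F1 z := by
    intro r hr
    exact Filter.eventually_atBot.1 (hstd2.eventually (lt_mem_nhds hr))
  have hex : ∃ t, 1 ≤ (1 + δ) * p (t + 1) := by
    by_contra hno
    push Not at hno
    have hbnn : ∀ t, 0 ≤ b t := by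
      intro t
      cases t with
      | zero => rw [hb0]
      | succ t => rw [hb]; linarith [hno t]
    have haN : ∀ t, N ≤ t → a (t + 1) ≤ -(11 / 12 * c1) := by
      intro t ht
      apply hqs
      have h1 := hBmono t (fun s _ _ => hno s) t ht le_rfl
      have h2 := mul_le_mul_of_nonneg_left (by linarith [hbnn t] : B N ≤ B t + b t) hhp.le
      linarith
    have hAk : ∀ k : ℕ, A (N + k) ≤ A N - 11 / 12 * c1 * k := by
      intro k
      induction k with
      | zero => simp
      | succ k ih =>
        have h1 := hA (N + k)
        have h2 := haN (N + k) (by omega)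
        rw [← add_assoc, h1]; push_cast; linarith
    obtain ⟨Z, hZ⟩ := hev (1 / (1 + δ)) (by rw [div_lt_one (by linarith)]; linarith)
    obtain ⟨k, hk⟩ := exists_nat_ge ((A N + 1 - Z / η) / (11 / 12 * c1))
    rw [div_le_iff₀ (by positivity)] at hk
    have h1 : A (N + k) + a (N + k) ≤ Z / η := by linarith [hAk k, hau (N + k)]
    rw [le_div_iff₀ hη] at h1
    have h2 := hZ (η * (A (N + k) + a (N + k))) (by linarith)
    rw [← hp, div_lt_iff₀ (by linarith)] at h2
    linarith [hno (N + k)]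
  classical
  obtain ⟨T, hT1, hT2⟩ : ∃ T, 1 ≤ (1 + δ) * p (T + 1) ∧ ∀ t < T, (1 + δ) * p (t + 1) < 1 :=
    ⟨Nat.find hex, Nat.find_spec hex, fun t ht => not_le.1 (Nat.find_min hex ht)⟩
  have hNT : N ≤ T := by
    by_contra hlt
    linarith [hbN T (by omega)]
  have hBT : B N ≤ B T := hBmono T (fun t _ ht => hT2 t ht) T hNT le_rfl
  have hBTj : ∀ j : ℕ, B T - δ * j ≤ B (T + j) := by
    intro j
    induction j with
    | zero => simp
    | succ j ih =>
      rw [← add_assoc, hB]; push_cast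
      linarith [hbl (T + j + 1)]
  -- K
  obtain ⟨K, hK1, hK2⟩ : ∃ K : ℕ, c1 / (3 * (h * δ)) ≤ K ∧ (K : ℝ) ≤ c1 / (3 * (h * δ)) + 1 :=
    ⟨_, Nat.le_ceil _, (Nat.ceil_lt_add_one (by positivity)).le⟩
  have hhd : 0 < h * δ := by positivity
  have hhd60 : h * δ ≤ 1 / 60 := by
    have := mul_le_mul hh4 hδ1.le hδ.le (by norm_num : (0 : ℝ) ≤ 1 / 4)
    linarith
  have hK1' : c1 / 3 ≤ h * δ * K := by
    rw [div_le_iff₀ (by positivity)] at hK1; linarith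
  have hK2' : h * δ * K ≤ c1 / 3 + h * δ := by
    have := mul_le_mul_of_nonneg_left hK2 hhd.le
    have e : h * δ * (c1 / (3 * (h * δ)) + 1) = c1 / 3 + h * δ := by field_simp
    linarith
  have haK : ∀ j : ℕ, j ≤ K → a (T + j + 1) ≤ -(11 / 12 * c1) := by
    intro j hj
    apply hqs
    have h1 := hBTj j
    have h2 := hbl (T + j)
    have h3 : (j : ℝ) ≤ K := by exact_mod_cast hj
    have h4 : B N - δ * (K + 1) ≤ B (T + j) + b (T + j) := by
      have := mul_le_mul_of_nonneg_left h3 hδ.le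
      linarith
    have h5 := mul_le_mul_of_nonneg_left h4 hhp.le
    have e : h * (B N - δ * (K + 1)) = h * B N - h * δ * K - h * δ := by ring
    linarith
  have hAK : ∀ j : ℕ, j ≤ K → A (T + j) ≤ A T - 11 / 12 * c1 * j := by
    intro j
    induction j with
    | zero => intro _; simp
    | succ j ih =>
      intro hj
      have h1 := ih (by omega)
      have h2 := haK j (by omega)
      rw [← add_assoc, hA]; push_cast; linarith
  have hKpos : 1 ≤ K := by
    by_contra h0
    have : K = 0 := by omega
    rw [this] at hK1'; push_cast at hK1'; linarith
  set S := T + K with hS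
  have haS : a S ≤ 0 := by
    obtain ⟨k, rfl⟩ : ∃ k, K = k + 1 := ⟨K - 1, by omega⟩
    have := haK k (by omega)
    rw [hS, ← add_assoc]; linarith
  have hAS : A S ≤ A T - 11 / 12 * c1 * K := hAK K le_rfl
  -- M
  obtain ⟨M, hM1, hM2⟩ : ∃ M : ℕ, c1 ^ 2 / (75 * (h * δ)) ≤ M ∧
      (M : ℝ) ≤ c1 ^ 2 / (75 * (h * δ)) + 1 :=
    ⟨_, Nat.le_ceil _, (Nat.ceil_lt_add_one (by positivity)).le⟩
  have hM1' : c1 ^ 2 / 75 ≤ h * δ * M := by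
    rw [div_le_iff₀ (by positivity)] at hM1; linarith
  have hM2' : h * δ * M ≤ c1 ^ 2 / 75 + h * δ := by
    have := mul_le_mul_of_nonneg_left hM2 hhd.le
    have e : h * δ * (c1 ^ 2 / (75 * (h * δ)) + 1) = c1 ^ 2 / 75 + h * δ := by field_simp
    linarith
  have hMpos : 1 ≤ M := by
    by_contra h0
    have : M = 0 := by omega
    rw [this] at hM1'; push_cast at hM1'; nlinarith
  set β := δ * c3 / (8 / 5) with hβ
  have hβp : 0 < β := by positivity
  -- as long as A + a is low, b is quite negative
  have hlow : ∀ t, A t + a t ≤ A S + (M + 1) * (1 / 2 + δ) → b (t + 1) ≤ -β := by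
    intro t ht
    have h1 : 1 / (1 + δ) ≤ F1 (η * (A T + a T)) := by
      rw [← hp, div_le_iff₀ (by linarith)]; linarith
    have h2 := hmain1 δ hδ hδ4.le _ h1
    have h3 : η * (A t + a t) ≤ η * (A T + a T) - c1 ^ 2 / (30 * L * δ) := by
      have g1 : A t + a t ≤ A T - 11 / 12 * c1 * K + (M + 1) * (17 / 30) := by
        have : (M + 1) * (1 / 2 + δ) ≤ ((M : ℝ) + 1) * (17 / 30) := by
          apply mul_le_mul_of_nonneg_left _ (by positivity); linarith
        linarith
      have g2 : A t + a t - (A T + a T) ≤ - (11 / 12 * c1 * K) + (M + 2) * (17 / 30) := by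
        linarith [hal T]
      have g3 := mul_le_mul_of_nonneg_left g2 hhd.le
      have g4 : c1 * (c1 / 3) ≤ c1 * (h * δ * K) := mul_le_mul_of_nonneg_left hK1' hc1p.le
      have g5 : h * δ * (A t + a t - (A T + a T)) ≤ - (c1 ^ 2 / 30) := by
        have k1 : h * δ ≤ 1 / 4 * (c1 ^ 2 / 300) :=
          mul_le_mul hh4 hδ3.le hδ.le (by norm_num)
        have k2 : h * δ * (-(11 / 12 * c1 * K) + (M + 2) * (17 / 30))
          = -(11 / 12) * (c1 * (h * δ * K)) + 17 / 30 * (h * δ * M) + 17 / 15 * (h * δ) := by ring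
        have k3 : c1 * (c1 / 3) = c1 ^ 2 / 3 := by ring
        have k4 : 0 < c1 ^ 2 := by positivity
        rw [k2] at g3
        linarith
      have e : c1 ^ 2 / (30 * L * δ) = (c1 ^ 2 / 30) / (L * δ) := by field_simp
      have g6 : c1 ^ 2 / (30 * L * δ) ≤ η * (A T + a T) - η * (A t + a t) := by
        rw [e, div_le_iff₀ (by positivity)]
        have : (η * (A T + a T) - η * (A t + a t)) * (L * δ)
          = - (h * δ * (A t + a t - (A T + a T))) := by rw [hh]; ring
        linarith
      linarith
    have h4 := h2.trans (hanti h3)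
    rw [← hp, div_le_iff₀ (by linarith)] at h4
    rw [hb]
    have h5 : δ * c3 / (1 + c3 + δ) ≤ (1 + δ) * p (t + 1) - 1 := by
      rw [div_le_iff₀ (by linarith)]
      nlinarith
    have h6 : β ≤ δ * c3 / (1 + c3 + δ) := by
      rw [hβ]
      apply div_le_div_of_nonneg_left (by positivity) (by linarith) (by linarith)
    linarith
  -- until q crosses, A decreasing
  have hphase : ∀ m : ℕ, (∀ k < m, (1 + δ) * q (S + k + 1) < 1 / 2) →
      A (S + m) ≤ A S ∧ a (S + m) ≤ 0 ∧ B (S + m) ≤ B S - β * m := by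
    intro m
    induction m with
    | zero => intro _; simpa using haS
    | succ m ih =>
      intro hm
      obtain ⟨i1, i2, i3⟩ := ih (fun k hk => hm k (by omega))
      have h1 := hm m (by omega)
      have h2 := ha (S + m)
      have h3 : a (S + m + 1) ≤ 0 := by linarith
      have h4 := hlow (S + m) (by
        have : (0 : ℝ) ≤ (M + 1) * (1 / 2 + δ) := by positivity
        linarith)
      refine ⟨?_, h3, ?_⟩
      · rw [← add_assoc, hA]; linarith
      · rw [← add_assoc, hB]; push_cast; linarith
  have hex2 : ∃ m, 1 / 2 ≤ (1 + δ) * q (S + m + 1) := by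
    by_contra hno
    push Not at hno
    obtain ⟨Z, hZ⟩ := hev (1 / 2) (by norm_num)
    obtain ⟨k, hk⟩ := exists_nat_ge ((B S + 1 - Z / η) / β)
    rw [div_le_iff₀ (by positivity)] at hk
    obtain ⟨-, -, i3⟩ := hphase k (fun k _ => hno k)
    have hbu : b (S + k) ≤ 1 := by
      rcases Nat.eq_zero_or_pos (S + k) with h0 | h0
      · rw [h0, hb0]; norm_num
      · obtain ⟨r, hr⟩ : ∃ r, S + k = r + 1 := ⟨S + k - 1, by omega⟩
        rw [hr, hb, hp]
        have := mul_nonneg (by linarith : (0 : ℝ) ≤ 1 + δ) (hF01 (η * (A r + a r))).1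
        linarith
    have h1 : B (S + k) + b (S + k) ≤ Z / η := by linarith
    rw [le_div_iff₀ hη] at h1
    have h2 := hZ (η * (B (S + k) + b (S + k))) (by linarith)
    rw [← hq] at h2
    have h3 := mul_le_mul_of_nonneg_left h2.le (by linarith : (0 : ℝ) ≤ 1 + δ)
    linarith [hno k]
  obtain ⟨m, hm1, hm2⟩ : ∃ m, 1 / 2 ≤ (1 + δ) * q (S + m + 1) ∧
      ∀ k < m, (1 + δ) * q (S + k + 1) < 1 / 2 :=
    ⟨Nat.find hex2, Nat.find_spec hex2, fun t ht => not_le.1 (Nat.find_min hex2 ht)⟩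
  obtain ⟨i1, i2, -⟩ := hphase m hm2
  set G := S + m with hG
  have hAG : ∀ j : ℕ, A (G + j) ≤ A S + j * (1 / 2 + δ) := by
    intro j
    induction j with
    | zero => simpa using i1
    | succ j ih =>
      rw [← add_assoc, hA]; push_cast
      linarith [hau (G + j + 1)]
  have hbG : ∀ j : ℕ, j ≤ M → b (G + j + 1) ≤ -β := by
    intro j hj
    apply hlow
    have h1 := hAG j
    have h2 := hau (G + j)
    have h3 : (j : ℝ) ≤ M := by exact_mod_cast hj
    have h4 := mul_le_mul_of_nonneg_right h3 (by linarith : (0 : ℝ) ≤ 1 / 2 + δ)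
    linarith
  have hBG : ∀ j : ℕ, j ≤ M → B (G + j) ≤ B G - β * j := by
    intro j
    induction j with
    | zero => intro _; simp
    | succ j ih =>
      intro hj
      have h1 := ih (by omega)
      have h2 := hbG j (by omega)
      rw [← add_assoc, hB]; push_cast; linarith
  have hbM : b (G + M) ≤ 0 := by
    obtain ⟨k, rfl⟩ : ∃ k, M = k + 1 := ⟨M - 1, by omega⟩
    have := hbG k (by omega)
    rw [← add_assoc]; linarith
  refine ⟨G + M, ?_, ?_⟩
  · have e : 3 * η * L * δ = 3 * (h * δ) := by rw [hh]; ring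
    rw [e]
    refine hK1.trans ?_
    have : K ≤ G + M + 1 := by omega
    exact_mod_cast this
  · have h1 : 1 / (2 * (1 + δ)) ≤ F1 (η * (B G + b G)) := by
      rw [← hq, div_le_iff₀ (by linarith)]; linarith
    refine (hmain2 δ hδ hδ4.le _ h1).trans ?_
    rw [hq]
    apply hanti
    have g1 : B (G + M) + b (G + M) ≤ B G + b G + δ - β * M := by
      linarith [hBG M le_rfl, hbl G]
    have g2 := mul_le_mul_of_nonneg_left g1 hη.le
    have g3 : η * δ ≤ δ / (4 * L) := by
      have := mul_le_mul_of_nonneg_right hη' hδ.le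
      have e : 1 / (4 * L) * δ = δ / (4 * L) := by ring
      linarith
    have g4 : c3 * c1 ^ 2 / (120 * L) ≤ η * (β * M) := by
      rw [div_le_iff₀ (by positivity)]
      have e : η * (β * M) * (120 * L) = 75 * c3 * (h * δ * M) := by rw [hβ, hh]; ring
      rw [e]
      have := mul_le_mul_of_nonneg_left hM1' hc3p.le
      linarith
    have e : η * (B G + b G + δ - β * M) = η * (B G + b G) + η * δ - η * (β * M) := by ring
    linarith

lemma gap_lower (δ : ℝ) (x y : Fin 2 → ℝ) (hx1 : x 1 = 1 - x 0) (hy1 : y 1 = 1 - y 0)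
    (hx : x 0 ≤ 1) :
    y 0 - 1 / 2 ≤ dualGap (Adelta δ) x y := by
  have hc := isCompact_stdSimplex (𝕜 := ℝ) (Fin 2)
  have b1 : BddAbove ((fun y' => x ⬝ᵥ (Adelta δ).mulVec y') '' stdSimplex ℝ (Fin 2)) := by
    apply (hc.image _).bddAbove
    simp only [dotProduct, Matrix.mulVec]
    fun_prop
  have b2 : BddBelow ((fun x' => x' ⬝ᵥ (Adelta δ).mulVec y) '' stdSimplex ℝ (Fin 2)) := by
    apply (hc.image _).bddBelow
    simp only [dotProduct, Matrix.mulVec]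
    fun_prop
  have s1 := single_mem_stdSimplex ℝ (1 : Fin 2)
  have h1 := le_csSup b1 (Set.mem_image_of_mem _ s1)
  have h2 := csInf_le b2 (Set.mem_image_of_mem _ s1)
  simp [Adelta, Matrix.mulVec, dotProduct, Fin.sum_univ_two, Pi.single_apply] at h1 h2
  unfold dualGap
  simp only [Adelta, Matrix.mulVec, dotProduct, Fin.sum_univ_two] at h1 h2 ⊢
  simp at h1 h2 ⊢
  linarith

/-- under the standard and main assumptions on the regularizer `R`, for any
`δ < min{1/15, c1/6, c1²/300, δ'}` and step size `η ≤ 1/(4L)`, the OFTRL dynamics on `A_δ`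
admits an iteration `t ≥ c1/(3ηLδ)` whose duality gap is at least `c2`. -/
theorem oftrl_slow_last_iterate
    (R : ℝ → ℝ) (η L c1 c2 c3 δ' δ : ℝ) (F1 Fη : ℝ → ℝ)
    (hL : 0 < L) (hη : 0 < η) (hη' : η ≤ 1 / (4 * L))
    -- F1 is the response function for step size 1, Fη for step size η
    (hF1 : ∀ e : ℝ, F1 e ∈ Set.Icc (0 : ℝ) 1 ∧ ∀ z ∈ Set.Icc (0 : ℝ) 1, z ≠ F1 e →
      F1 e * e + R (F1 e) < z * e + R z)
    (hFη : ∀ e : ℝ, Fη e ∈ Set.Icc (0 : ℝ) 1 ∧ ∀ z ∈ Set.Icc (0 : ℝ) 1, z ≠ Fη e →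
      Fη e * e + (1 / η) * R (Fη e) < z * e + (1 / η) * R z)
    -- standard assumption
    (hstd1 : F1 0 = 1 / 2)
    (hstd2 : Tendsto F1 atBot (nhds 1))
    (hstd3 : Tendsto F1 atTop (nhds 0))
    (hstd4 : ∀ a b : ℝ, |F1 a - F1 b| ≤ L * |a - b|)
    -- main assumption, with c1 = 1/2 − F1(1/(20L))
    (hc1 : c1 = 1 / 2 - F1 (1 / (20 * L)))
    (hδ'pos : 0 < δ') (hc2pos : 0 < c2) (hc3 : c3 ∈ Set.Ioc (0 : ℝ) (1 / 2))
    (hmain1 : ∀ d : ℝ, 0 < d → d ≤ δ' → ∀ E : ℝ, 1 / (1 + d) ≤ F1 E →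
      (1 + c3) / (1 + c3 + d) ≤ F1 (E - c1 ^ 2 / (30 * L * d)))
    (hmain2 : ∀ d : ℝ, 0 < d → d ≤ δ' → ∀ E : ℝ, 1 / (2 * (1 + d)) ≤ F1 E →
      1 / 2 + c2 ≤ F1 (E - c3 * c1 ^ 2 / (120 * L) + d / (4 * L)))
    -- the hard instance parameter
    (hδ : 0 < δ) (hδ1 : δ < 1 / 15) (hδ2 : δ < c1 / 6) (hδ3 : δ < c1 ^ 2 / 300)
    (hδ4 : δ < δ')
    -- the OFTRL dynamics on A_δ
    (x y : ℕ → Fin 2 → ℝ) (hdyn : IsOFTRL2 Fη (Adelta δ) x y) :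
    ∃ t : ℕ, c1 / (3 * η * L * δ) ≤ (t : ℝ) ∧ c2 ≤ dualGap (Adelta δ) (x t) (y t) := by
  have hanti := F_anti R F1 hF1
  have hsc := F_scale R F1 Fη η hη hF1 hFη
  have hex : ∀ t, exSeq (Adelta δ) y (t + 1) = (1 + δ) * y (t + 1) 0 - 1 / 2 := by
    intro t
    have h1 := (hdyn (t + 1) (by omega)).2.2.2
    simp [exSeq, Adelta, Matrix.mulVec, dotProduct, Fin.sum_univ_two, h1]
    ring
  have hey : ∀ t, eySeq (Adelta δ) x (t + 1) = 1 - (1 + δ) * x (t + 1) 0 := by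
    intro t
    have h1 := (hdyn (t + 1) (by omega)).2.1
    simp [eySeq, Adelta, Matrix.mulVec, dotProduct, Fin.sum_univ_two, h1]
    ring
  obtain ⟨t, ht1, ht2⟩ := core η L c1 c2 c3 δ' δ F1 hL hη hη' (fun e => (hF1 e).1) hanti hstd1
    hstd2 hstd4 hc1 hc3 hmain1 hmain2 hδ hδ1 hδ2 hδ3 hδ4 (fun t => x t 0) (fun t => y t 0)
    (exSeq (Adelta δ) y) (eySeq (Adelta δ) x) (cumSum (exSeq (Adelta δ) y))
    (cumSum (eySeq (Adelta δ) x)) (by simp [exSeq]) (by simp [eySeq])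
    (by simp [cumSum, exSeq]) (by simp [cumSum, eySeq])
    (fun t => by simp [cumSum, Finset.sum_range_succ _ (t + 1)])
    (fun t => by simp [cumSum, Finset.sum_range_succ _ (t + 1)]) hex hey
    (fun t => by
      have := (hdyn (t + 1) (by omega)).1
      rw [hsc] at this; simpa using this)
    (fun t => by
      have := (hdyn (t + 1) (by omega)).2.2.1
      rw [hsc] at this; simpa using this)
  refine ⟨t + 1, ht1, ?_⟩
  obtain ⟨d1, d2, d3, d4⟩ := hdyn (t + 1) (by omega)
  have hx : x (t + 1) 0 ≤ 1 := by rw [d1]; exact (hFη _).1.2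
  have := gap_lower δ (x (t + 1)) (y (t + 1)) d2 d4 hx
  linarith

end
end

section
/- Suppose the regularizer R : [0,1] → ℝ satisfies the standard assumption with Lipschitz constant L > 0 and the main assumption, and fix any step size η with 0 < η ≤ 1/(4L). Then there is no function f : ℕ → ℝ satisfying both: (1) for every matrix A ∈ [0,1]^{2×2} and every T ≥ 1, the OFTRL iterates (x^T, y^T) with regularizer R and step size η on the game A satisfy DualGap(x^T, y^T) ≤ f(T); and (2) lim_{T→∞} f(T) = 0. -/
open Set Matrix Filter

noncomputable section

/-- Linear upper bound for a cumulative sum. -/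
lemma lin_upper (E e : ℕ → ℝ) (hE : ∀ t, E (t + 1) = E t + e (t + 1)) (k n : ℕ) (c : ℝ)
    (h : ∀ j, j < n → e (k + j + 1) ≤ c) : ∀ j, j ≤ n → E (k + j) ≤ E k + j * c := by
  intro j
  induction j with
  | zero => intro _; simp
  | succ j ih =>
    intro hj
    have h1 := ih (by omega)
    have h2 := h j (by omega)
    have h3 := hE (k + j)
    rw [← add_assoc, h3]
    push_cast
    linarith

/-- Linear lower bound for a cumulative sum. -/
lemma lin_lower (E e : ℕ → ℝ) (hE : ∀ t, E (t + 1) = E t + e (t + 1)) (k n : ℕ) (c : ℝ)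
    (h : ∀ j, j < n → c ≤ e (k + j + 1)) : ∀ j, j ≤ n → E k + j * c ≤ E (k + j) := by
  intro j
  induction j with
  | zero => intro _; simp
  | succ j ih =>
    intro hj
    have h1 := ih (by omega)
    have h2 := h j (by omega)
    have h3 := hE (k + j)
    rw [← add_assoc, h3]
    push_cast
    linarith

/-- If a cumulative sum decreases linearly, the response function eventually exceeds any
level below `1`. -/
lemma lin_escape (F : ℝ → ℝ) (hbot : Tendsto F atBot (nhds 1)) (E e : ℕ → ℝ)
    (hE : ∀ t, E (t + 1) = E t + e (t + 1)) (he : ∀ t, e t ≤ 1) (k : ℕ) (c : ℝ) (hc : 0 < c)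
    (h : ∀ j, e (k + j + 1) ≤ -c) (v : ℝ) (hv : v < 1) :
    ∃ j, v < F (E (k + j) + e (k + j)) := by
  have h1 : ∀ᶠ z in atBot, v < F z := hbot.eventually (lt_mem_nhds hv)
  obtain ⟨z0, hz0⟩ := eventually_atBot.1 h1
  obtain ⟨j, hj⟩ := exists_nat_gt ((E k + 1 - z0) / c)
  refine ⟨j, hz0 _ ?_⟩
  have h2 := lin_upper E e hE k j (-c) (fun j _ => h j) j le_rfl
  have h3 := he (k + j)
  rw [div_lt_iff₀ hc] at hj
  linarith

set_option maxHeartbeats 2000000 in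
lemma core_s6 (F : ℝ → ℝ) (q δ c1 c2 c3 : ℝ) (hq : 4 ≤ q) (hδ : 0 < δ) (hδc : δ ≤ c1 / 100)
    (hc1 : c1 ≤ 1 / 20) (hc3 : 0 < c3) (hc3' : c3 ≤ 1 / 2)
    (hF0 : ∀ e, 0 ≤ F e) (hF1 : ∀ e, F e ≤ 1) (hanti : Antitone F) (hhalf : F 0 = 1 / 2)
    (hlip : ∀ s, 0 ≤ s → F (-s) ≤ 1 / 2 + s / q) (hbot : Tendsto F atBot (nhds 1))
    (hFc : F (q / 20) = 1 / 2 - c1)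
    (hm1 : ∀ E, 1 / (1 + δ) ≤ F E → (1 + c3) / (1 + c3 + δ) ≤ F (E - c1 ^ 2 * q / (30 * δ)))
    (hm2 : ∀ E, 1 / (2 * (1 + δ)) ≤ F E → 1 / 2 + c2 ≤ F (E - c3 * c1 ^ 2 * q / 120 + δ))
    (a b ex ey Ex Ey : ℕ → ℝ)
    (hex0 : ex 0 = 0) (hey0 : ey 0 = 0) (hEx0 : Ex 0 = 0) (hEy0 : Ey 0 = 0)
    (ha : ∀ t, a (t + 1) = F (Ex t + ex t)) (hb : ∀ t, b (t + 1) = F (Ey t + ey t))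
    (hex : ∀ t, ex (t + 1) = (1 + δ) * b (t + 1) - 1 / 2)
    (hey : ∀ t, ey (t + 1) = 1 - (1 + δ) * a (t + 1))
    (hEx : ∀ t, Ex (t + 1) = Ex t + ex (t + 1)) (hEy : ∀ t, Ey (t + 1) = Ey t + ey (t + 1)) :
    ∃ T : ℕ, 1 ≤ T ∧ q / (20 * δ) - 1 ≤ T ∧ 1 / 2 + c2 ≤ b T := by
  have hc1p : 0 < c1 := by linarith
  have hδs : δ ≤ 1 / 2000 := by linarith
  have hqp : 0 < q := by linarith
  have ha0 : ∀ t, 0 ≤ a (t + 1) := fun t => by rw [ha]; exact hF0 _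
  have ha1 : ∀ t, a (t + 1) ≤ 1 := fun t => by rw [ha]; exact hF1 _
  have hb0 : ∀ t, 0 ≤ b (t + 1) := fun t => by rw [hb]; exact hF0 _
  have hb1 : ∀ t, b (t + 1) ≤ 1 := fun t => by rw [hb]; exact hF1 _
  have hexl : ∀ t, -(1 / 2) ≤ ex t := by
    intro t
    cases t with
    | zero => rw [hex0]; norm_num
    | succ t => rw [hex]; nlinarith [hb0 t]
  have hexu : ∀ t, ex t ≤ 1 := by
    intro t
    cases t with
    | zero => rw [hex0]; norm_num
    | succ t => rw [hex]; nlinarith [hb0 t, hb1 t]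
  have heyl : ∀ t, -δ ≤ ey t := by
    intro t
    cases t with
    | zero => rw [hey0]; linarith
    | succ t => rw [hey]; nlinarith [ha0 t, ha1 t]
  have heyu : ∀ t, ey t ≤ 1 := by
    intro t
    cases t with
    | zero => rw [hey0]; norm_num
    | succ t => rw [hey]; nlinarith [ha0 t, ha1 t]
  have hex1 : ex 1 = δ / 2 := by
    have h1 := hex 0
    have h2 := hb 0
    rw [hEy0, hey0, add_zero, hhalf] at h2
    rw [zero_add] at h1 h2
    rw [h1, h2]; ring
  have hEx1 : Ex 1 = δ / 2 := by
    have h1 := hEx 0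
    rw [zero_add, hEx0, hex1] at h1
    linarith
  -- phase 0
  have hsum : ∀ t : ℕ, -((t : ℝ) / 2) ≤ Ex t + ex t := by
    intro t
    cases t with
    | zero => rw [hEx0, hex0]; simp
    | succ t =>
      cases t with
      | zero => rw [zero_add, hEx1, hex1]; push_cast; linarith
      | succ t =>
        have h1 := lin_lower Ex ex hEx 1 (t + 1) (-(1 / 2)) (fun j _ => hexl _) (t + 1) le_rfl
        have h2 := hexl (t + 1 + 1)
        rw [show 1 + (t + 1) = t + 1 + 1 by ring] at h1
        push_cast at h1 ⊢
        linarith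
  have haup : ∀ t : ℕ, (t : ℝ) ≤ q / 2 → a (t + 1) ≤ 3 / 4 := by
    intro t ht
    rw [ha]
    have h1 := hanti (hsum t)
    have h2 := hlip ((t : ℝ) / 2) (by positivity)
    have h3 : (t : ℝ) / 2 / q ≤ 1 / 4 := by
      rw [div_le_iff₀ hqp]; linarith
    linarith
  have hthr1 : (3 : ℝ) / 4 < 1 / (1 + δ) := by
    rw [lt_div_iff₀ (by linarith)]; linarith
  have hthr1' : 1 / (1 + δ) < 1 := by
    rw [div_lt_one (by linarith)]; linarith
  obtain ⟨m, hm⟩ : ∃ m : ℕ, m = ⌊q / 2⌋₊ + 1 := ⟨_, rfl⟩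
  have hmq : q / 2 ≤ m := by
    have := Nat.lt_floor_add_one (q / 2)
    rw [hm]; push_cast; linarith
  have hmle : ∀ t : ℕ, t < m → (t : ℝ) ≤ q / 2 := by
    intro t ht
    have h1 : t ≤ ⌊q / 2⌋₊ := by omega
    exact (Nat.le_floor_iff (by linarith)).1 h1
  have hEym : q / 10 ≤ Ey m := by
    have h1 := lin_lower Ey ey hEy 0 m (1 / 5) (fun j hj => by
      have h2 := haup j (hmle j hj)
      rw [zero_add, hey]
      nlinarith [ha0 j]) m le_rfl
    rw [zero_add, hEy0] at h1
    linarith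
  have hH4 : ∀ k : ℕ, (∀ s, s < k → a (s + 1) < 1 / (1 + δ)) →
      ∀ t, m ≤ t → t ≤ k → q / 10 ≤ Ey t := by
    intro k hk t hmt htk
    obtain ⟨j, rfl⟩ := Nat.exists_eq_add_of_le hmt
    have h1 := lin_lower Ey ey hEy m j 0 (fun i hi => by
      have h2 := hk (m + i) (by omega)
      rw [hey]
      rw [lt_div_iff₀ (by linarith)] at h2
      linarith) j le_rfl
    linarith
  have hH5 : ∀ t, q / 20 + δ ≤ Ey t → ex (t + 1) ≤ -(c1 / 2) := by
    intro t ht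
    have h1 : b (t + 1) ≤ 1 / 2 - c1 := by
      rw [hb, ← hFc]
      apply hanti
      linarith [heyl t]
    rw [hex]
    nlinarith [hb0 t]
  have hT1 : ∃ k, 1 / (1 + δ) ≤ a (k + 1) := by
    by_contra hcon
    push Not at hcon
    obtain ⟨j, hj⟩ := lin_escape F hbot Ex ex hEx hexu m (c1 / 2) (by linarith)
      (fun j => hH5 _ (by
        have := hH4 (m + j) (fun s _ => hcon s) (m + j) (by omega) le_rfl
        linarith)) _ hthr1'
    rw [← ha] at hj
    linarith [hcon (m + j)]
  classical
  obtain ⟨k, hk, hkmin⟩ : ∃ k, 1 / (1 + δ) ≤ a (k + 1) ∧ ∀ s, s < k → a (s + 1) < 1 / (1 + δ) :=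
    ⟨Nat.find hT1, Nat.find_spec hT1, fun s hs => not_le.1 (Nat.find_min hT1 hs)⟩
  have hmk : m ≤ k := by
    by_contra hlt
    have := haup k (hmle k (by omega))
    linarith
  have hEyk := hH4 k hkmin k hmk le_rfl
  -- phase 1
  obtain ⟨N1, hN1⟩ : ∃ n : ℕ, n = ⌊q / (20 * δ)⌋₊ := ⟨_, rfl⟩
  have hN1u : (N1 : ℝ) * δ ≤ q / 20 := by
    have h1 : (N1 : ℝ) ≤ q / (20 * δ) := by
      rw [hN1]; exact Nat.floor_le (by positivity)
    rw [le_div_iff₀ (by positivity)] at h1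
    linarith
  have hN1l : q / (20 * δ) - 1 ≤ N1 := by
    have := Nat.lt_floor_add_one (q / (20 * δ))
    rw [hN1]; linarith
  have hr : 400 ≤ q / (20 * δ) := by
    rw [le_div_iff₀ (by positivity)]; linarith
  have hN1pos : 1 ≤ N1 := by
    have : (1 : ℝ) ≤ N1 := by linarith
    exact_mod_cast this
  have hph1 : ∀ j, j < N1 → ex (k + j + 1) ≤ -(c1 / 2) := by
    intro j hj
    apply hH5
    have h1 := lin_lower Ey ey hEy k j (-δ) (fun i _ => heyl _) j le_rfl
    have h2 : ((j : ℝ) + 1) ≤ N1 := by exact_mod_cast hj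
    nlinarith
  have hB := lin_upper Ex ex hEx k N1 _ hph1 N1 le_rfl
  obtain ⟨T2, hT2⟩ : ∃ n, n = k + N1 := ⟨_, rfl⟩
  have hexT2 : ex T2 ≤ 0 := by
    have h1 := hph1 (N1 - 1) (by omega)
    rw [show k + (N1 - 1) + 1 = T2 by omega] at h1
    linarith
  rw [← hT2] at hB
  obtain ⟨N2, hN2⟩ : ∃ n : ℕ, n = ⌊c1 ^ 2 * q / (60 * δ)⌋₊ + 1 := ⟨_, rfl⟩
  have hN2u : (N2 : ℝ) ≤ c1 ^ 2 * q / (60 * δ) + 1 := by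
    have := Nat.floor_le (show 0 ≤ c1 ^ 2 * q / (60 * δ) by positivity)
    rw [hN2]; push_cast; linarith
  have hN2l : c1 ^ 2 * q / (60 * δ) ≤ N2 := by
    have := Nat.lt_floor_add_one (c1 ^ 2 * q / (60 * δ))
    rw [hN2]; push_cast; linarith
  have hnum : Ex T2 + N2 + 1 ≤ Ex k + ex k - c1 ^ 2 * q / (30 * δ) := by
    have h0 := hexl k
    obtain ⟨r, hrdef⟩ : ∃ r, r = q / δ := ⟨_, rfl⟩
    have e1 : q / (20 * δ) = r / 20 := by rw [hrdef]; field_simp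
    have e2 : c1 ^ 2 * q / (60 * δ) = c1 ^ 2 * r / 60 := by rw [hrdef]; field_simp
    have e3 : c1 ^ 2 * q / (30 * δ) = c1 ^ 2 * r / 30 := by rw [hrdef]; field_simp
    have hc1r : 400 ≤ c1 * r := by
      rw [hrdef, ← mul_div_assoc, le_div_iff₀ hδ]
      linarith [mul_le_mul_of_nonneg_left hq hc1p.le]
    rw [e2] at hN2u
    rw [e3]
    rw [e1] at hN1l
    have h5 : c1 ^ 2 * r ≤ c1 * r / 20 := by
      linarith [mul_nonneg (show 0 ≤ c1 * r by linarith) (sub_nonneg.2 hc1)]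
    have h6 : c1 * (r / 20 - 1) ≤ c1 * N1 := by
      exact mul_le_mul_of_nonneg_left hN1l hc1p.le
    linarith
  -- phase 2
  have hH6 : ∀ t, Ex t + ex t ≤ Ex T2 + N2 + 1 → ey (t + 1) ≤ -(δ * c3 / 2) := by
    intro t ht
    rw [ha] at hk
    have h1 := hm1 _ hk
    have h2 : F (Ex k + ex k - c1 ^ 2 * q / (30 * δ)) ≤ a (t + 1) := by
      rw [ha]; apply hanti; linarith
    have h3 := h1.trans h2
    rw [div_le_iff₀ (by linarith)] at h3
    rw [hey]
    have hpos : 0 < 1 + c3 + δ := by linarith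
    have h4 : (1 - (1 + δ) * a (t + 1)) * (1 + c3 + δ) ≤ -(δ * c3) := by nlinarith
    have h5 : -(δ * c3) ≤ -(δ * c3 / 2) * (1 + c3 + δ) := by
      have : 0 < δ * c3 := by positivity
      nlinarith
    exact le_of_mul_le_mul_right (h4.trans h5) hpos
  have hthr2 : 1 / (2 * (1 + δ)) < 1 := by
    rw [div_lt_one (by linarith)]; linarith
  have hph2 : ∀ i : ℕ, (∀ s, s < i → b (T2 + s + 1) < 1 / (2 * (1 + δ))) →
      Ex (T2 + i) ≤ Ex T2 ∧ ex (T2 + i) ≤ 0 := by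
    intro i hi
    have h0 : ∀ s, s < i → ex (T2 + s + 1) ≤ 0 := by
      intro s hs
      have := hi s hs
      rw [lt_div_iff₀ (by linarith)] at this
      rw [hex]; linarith
    constructor
    · have h1 := lin_upper Ex ex hEx T2 i 0 h0 i le_rfl
      linarith
    · cases i with
      | zero => exact hexT2
      | succ i => exact h0 i (by omega)
  have hN2nn : (0 : ℝ) ≤ N2 := Nat.cast_nonneg _
  have hT3 : ∃ i, 1 / (2 * (1 + δ)) ≤ b (T2 + i + 1) := by
    by_contra hcon
    push Not at hcon
    obtain ⟨j, hj⟩ := lin_escape F hbot Ey ey hEy heyu T2 (δ * c3 / 2) (by positivity)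
      (fun j => hH6 _ (by
        have := hph2 j (fun s _ => hcon s)
        linarith [this.1, this.2])) _ hthr2
    rw [← hb] at hj
    linarith [hcon j]
  obtain ⟨i, hi, himin⟩ : ∃ i, 1 / (2 * (1 + δ)) ≤ b (T2 + i + 1) ∧
      ∀ s, s < i → b (T2 + s + 1) < 1 / (2 * (1 + δ)) :=
    ⟨Nat.find hT3, Nat.find_spec hT3, fun s hs => not_le.1 (Nat.find_min hT3 hs)⟩
  have hP := hph2 i himin
  obtain ⟨P, hPdef⟩ : ∃ n, n = T2 + i := ⟨_, rfl⟩
  rw [← hPdef] at hP hi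
  -- phase 3
  have hph3 : ∀ j, j < N2 → ey (P + j + 1) ≤ -(δ * c3 / 2) := by
    intro j hj
    apply hH6
    have h1 := lin_upper Ex ex hEx P j 1 (fun i _ => hexu _) j le_rfl
    have h2 : ((j : ℝ) + 1) ≤ N2 := by exact_mod_cast hj
    linarith [hexu (P + j), hP.1]
  have hfin := lin_upper Ey ey hEy P N2 _ hph3 N2 le_rfl
  have heyP : ey (P + N2) ≤ 0 := by
    have h1 := hph3 (N2 - 1) (by omega)
    rw [show P + (N2 - 1) + 1 = P + N2 by omega] at h1
    have : 0 < δ * c3 := by positivity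
    linarith
  refine ⟨P + N2 + 1, by omega, ?_, ?_⟩
  · have : (N1 : ℝ) ≤ ((P + N2 + 1 : ℕ) : ℝ) := by
      exact_mod_cast (by omega : N1 ≤ P + N2 + 1)
    linarith
  · rw [hb] at hi ⊢
    refine (hm2 _ hi).trans (hanti ?_)
    have h1 : c1 ^ 2 * q ≤ N2 * (60 * δ) := by
      rwa [div_le_iff₀ (by positivity)] at hN2l
    have h2 : c3 * (c1 ^ 2 * q) ≤ c3 * (N2 * (60 * δ)) := mul_le_mul_of_nonneg_left h1 hc3.le
    have h3 := heyl P
    linarith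

/-- The hard instance. -/
def hardGame (δ : ℝ) : Matrix (Fin 2) (Fin 2) ℝ := !![1 / 2 + δ, 1 / 2; 0, 1]

/-- State `(Ex, ex, Ey, ey)` of the dynamics. -/
def hardState (F : ℝ → ℝ) (δ : ℝ) : ℕ → ℝ × ℝ × ℝ × ℝ
  | 0 => (0, 0, 0, 0)
  | t + 1 =>
    let s := hardState F δ t
    let dx := (1 + δ) * F (s.2.2.1 + s.2.2.2) - 1 / 2
    let dy := 1 - (1 + δ) * F (s.1 + s.2.1)
    (s.1 + dx, dx, s.2.2.1 + dy, dy)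

/-- First coordinate of the x-player. -/
def hardA (F : ℝ → ℝ) (δ : ℝ) (t : ℕ) : ℝ :=
  F ((hardState F δ (t - 1)).1 + (hardState F δ (t - 1)).2.1)

/-- First coordinate of the y-player. -/
def hardB (F : ℝ → ℝ) (δ : ℝ) (t : ℕ) : ℝ :=
  F ((hardState F δ (t - 1)).2.2.1 + (hardState F δ (t - 1)).2.2.2)

/-- x-player's strategies. -/
def hardX (F : ℝ → ℝ) (δ : ℝ) (t : ℕ) : Fin 2 → ℝ := ![hardA F δ t, 1 - hardA F δ t]

/-- y-player's strategies. -/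
def hardY (F : ℝ → ℝ) (δ : ℝ) (t : ℕ) : Fin 2 → ℝ := ![hardB F δ t, 1 - hardB F δ t]

lemma hard_ex (F : ℝ → ℝ) (δ : ℝ) (t : ℕ) :
    exSeq (hardGame δ) (hardY F δ) t = (hardState F δ t).2.1 := by
  cases t with
  | zero => simp [exSeq, hardState]
  | succ t =>
    simp [exSeq, hardGame, hardY, hardState, hardB, Matrix.mulVec, dotProduct, Fin.sum_univ_two]
    ring

lemma hard_ey (F : ℝ → ℝ) (δ : ℝ) (t : ℕ) :
    eySeq (hardGame δ) (hardX F δ) t = (hardState F δ t).2.2.2 := by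
  cases t with
  | zero => simp [eySeq, hardState]
  | succ t =>
    simp [eySeq, hardGame, hardX, hardState, hardA, Matrix.mulVec, dotProduct, Fin.sum_univ_two]
    ring

lemma hard_Ex (F : ℝ → ℝ) (δ : ℝ) (t : ℕ) :
    cumSum (exSeq (hardGame δ) (hardY F δ)) t = (hardState F δ t).1 := by
  induction t with
  | zero => simp [cumSum, exSeq, hardState]
  | succ t ih =>
    unfold cumSum at ih ⊢
    rw [Finset.sum_range_succ, ih, hard_ex]
    simp [hardState]

lemma hard_Ey (F : ℝ → ℝ) (δ : ℝ) (t : ℕ) :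
    cumSum (eySeq (hardGame δ) (hardX F δ)) t = (hardState F δ t).2.2.1 := by
  induction t with
  | zero => simp [cumSum, eySeq, hardState]
  | succ t ih =>
    unfold cumSum at ih ⊢
    rw [Finset.sum_range_succ, ih, hard_ey]
    simp [hardState]

lemma hard_oftrl (F : ℝ → ℝ) (δ : ℝ) :
    IsOFTRL2 F (hardGame δ) (hardX F δ) (hardY F δ) := by
  intro t _
  rw [hard_Ex, hard_Ey, hard_ex, hard_ey]
  simp [hardX, hardY, hardA, hardB]

lemma hard_gap (δ : ℝ) (p r : ℝ) (hp : p ≤ 1) :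
    r - 1 / 2 ≤ dualGap (hardGame δ) ![p, 1 - p] ![r, 1 - r] := by
  have hmem : (![0, 1] : Fin 2 → ℝ) ∈ stdSimplex ℝ (Fin 2) := by
    constructor
    · intro i; fin_cases i <;> simp
    · simp [Fin.sum_univ_two]
  have hcpt : IsCompact (stdSimplex ℝ (Fin 2)) := isCompact_stdSimplex ℝ (Fin 2)
  have h1 : 1 / 2 ≤ sSup ((fun y' => ![p, 1 - p] ⬝ᵥ (hardGame δ).mulVec y') ''
      stdSimplex ℝ (Fin 2)) := by
    have hle : 1 / 2 ≤ ![p, 1 - p] ⬝ᵥ (hardGame δ).mulVec ![0, 1] := by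
      simp [hardGame, Matrix.mulVec, dotProduct, Fin.sum_univ_two]
      linarith
    refine hle.trans (le_csSup ?_ ⟨_, hmem, rfl⟩)
    refine (hcpt.image ?_).bddAbove
    simp only [Matrix.mulVec, dotProduct, Fin.sum_univ_two]
    fun_prop
  have h2 : sInf ((fun x' => x' ⬝ᵥ (hardGame δ).mulVec ![r, 1 - r]) ''
      stdSimplex ℝ (Fin 2)) ≤ 1 - r := by
    have hle : ![0, 1] ⬝ᵥ (hardGame δ).mulVec ![r, 1 - r] ≤ 1 - r := by
      simp [hardGame, Matrix.mulVec, dotProduct, Fin.sum_univ_two]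
    refine le_trans (csInf_le ?_ (Set.mem_image_of_mem _ hmem)) hle
    refine (hcpt.image ?_).bddBelow
    simp only [Matrix.mulVec, dotProduct, Fin.sum_univ_two]
    fun_prop
  unfold dualGap
  linarith

/-- under the standard and main assumptions on `R` and for any fixed step size
`η ≤ 1/(4L)`, there is no rate function `f : ℕ → ℝ` with `DualGap(x^T, y^T) ≤ f T` for all
games `A ∈ [0,1]^{2×2}` and all `T ≥ 1`, together with `f T → 0`. -/
theorem oftrl_no_last_iterate_rate
    (R : ℝ → ℝ) (η L c1 c2 c3 δ' : ℝ) (F1 Fη : ℝ → ℝ)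
    (hL : 0 < L) (hη : 0 < η) (hη' : η ≤ 1 / (4 * L))
    (hF1 : ∀ e : ℝ, F1 e ∈ Set.Icc (0 : ℝ) 1 ∧ ∀ z ∈ Set.Icc (0 : ℝ) 1, z ≠ F1 e →
      F1 e * e + R (F1 e) < z * e + R z)
    (hFη : ∀ e : ℝ, Fη e ∈ Set.Icc (0 : ℝ) 1 ∧ ∀ z ∈ Set.Icc (0 : ℝ) 1, z ≠ Fη e →
      Fη e * e + (1 / η) * R (Fη e) < z * e + (1 / η) * R z)
    (hstd1 : F1 0 = 1 / 2)
    (hstd2 : Tendsto F1 atBot (nhds 1))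
    (hstd3 : Tendsto F1 atTop (nhds 0))
    (hstd4 : ∀ a b : ℝ, |F1 a - F1 b| ≤ L * |a - b|)
    (hc1 : c1 = 1 / 2 - F1 (1 / (20 * L)))
    (hδ'pos : 0 < δ') (hc2pos : 0 < c2) (hc3 : c3 ∈ Set.Ioc (0 : ℝ) (1 / 2))
    (hmain1 : ∀ d : ℝ, 0 < d → d ≤ δ' → ∀ E : ℝ, 1 / (1 + d) ≤ F1 E →
      (1 + c3) / (1 + c3 + d) ≤ F1 (E - c1 ^ 2 / (30 * L * d)))
    (hmain2 : ∀ d : ℝ, 0 < d → d ≤ δ' → ∀ E : ℝ, 1 / (2 * (1 + d)) ≤ F1 E →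
      1 / 2 + c2 ≤ F1 (E - c3 * c1 ^ 2 / (120 * L) + d / (4 * L))) :
    ¬ ∃ f : ℕ → ℝ,
      (∀ A : Matrix (Fin 2) (Fin 2) ℝ, (∀ i j, A i j ∈ Set.Icc (0 : ℝ) 1) →
        ∀ x y : ℕ → Fin 2 → ℝ, IsOFTRL2 Fη A x y →
          ∀ T : ℕ, 1 ≤ T → dualGap A (x T) (y T) ≤ f T) ∧
      Tendsto f atTop (nhds 0) := by
  rintro ⟨f, hf, hlim⟩
  obtain ⟨hc3p, hc3h⟩ := hc3
  -- scaling
  have hscale : ∀ e, Fη e = F1 (η * e) := by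
    intro e
    by_contra hne
    have h1 := (hFη e).2 (F1 (η * e)) (hF1 _).1 (Ne.symm hne)
    have h2 := (hF1 (η * e)).2 (Fη e) (hFη e).1 hne
    have h3 := mul_lt_mul_of_pos_left h1 hη
    have e1 : ∀ z w : ℝ, η * (z * e + 1 / η * w) = z * (η * e) + w := by
      intro z w; field_simp
    rw [e1, e1] at h3
    linarith
  have hanti1 : Antitone F1 := by
    intro u v huv
    by_contra hlt
    push Not at hlt
    have h1 := (hF1 u).2 (F1 v) (hF1 v).1 hlt.ne'
    have h2 := (hF1 v).2 (F1 u) (hF1 u).1 hlt.ne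
    nlinarith
  have hc1le : c1 ≤ 1 / 20 := by
    have h1 := hstd4 0 (1 / (20 * L))
    rw [hstd1, zero_sub, abs_neg, abs_of_pos (show (0 : ℝ) < 1 / (20 * L) by positivity)] at h1
    have h2 : L * (1 / (20 * L)) = 1 / 20 := by field_simp
    rw [h2] at h1
    rw [hc1]
    exact (le_abs_self _).trans h1
  have hc1nn : 0 ≤ c1 := by
    have h1 := hanti1 (show (0 : ℝ) ≤ 1 / (20 * L) by positivity)
    rw [hstd1] at h1
    linarith
  have hcont : Continuous F1 := by
    have : LipschitzWith (Real.toNNReal L) F1 := by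
      apply LipschitzWith.of_dist_le_mul
      intro u v
      rw [Real.dist_eq, Real.dist_eq, Real.coe_toNNReal _ hL.le]
      exact hstd4 u v
    exact this.continuous
  have hc1pos : 0 < c1 := by
    rcases hc1nn.lt_or_eq with h | h
    · exact h
    exfalso
    obtain ⟨d, hd0, hdδ, hd1⟩ : ∃ d : ℝ, 0 < d ∧ d ≤ δ' ∧ d ≤ 1 :=
      ⟨min δ' 1, lt_min hδ'pos one_pos, min_le_left _ _, min_le_right _ _⟩
    have hv : 1 / (1 + d) < 1 := by rw [div_lt_one (by linarith)]; linarith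
    have hv' : 1 / 2 ≤ 1 / (1 + d) := by
      rw [div_le_div_iff₀ (by norm_num) (by linarith)]; linarith
    have h1 : ∀ᶠ z in atBot, 1 / (1 + d) < F1 z := hstd2.eventually (lt_mem_nhds hv)
    obtain ⟨z, hz⟩ := h1.exists
    have himg : 1 / (1 + d) ∈ Set.range F1 := by
      apply mem_range_of_exists_le_of_exists_ge hcont
      · exact ⟨0, by rw [hstd1]; exact hv'⟩
      · exact ⟨z, hz.le⟩
    obtain ⟨w, hw⟩ := himg
    have h2 := hmain1 d hd0 hdδ w hw.ge
    rw [← h] at h2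
    norm_num at h2
    rw [hw, div_le_div_iff₀ (by linarith) (by linarith)] at h2
    nlinarith
  -- choose T0 and δ
  obtain ⟨T0, hT0⟩ := eventually_atTop.1 (hlim.eventually (gt_mem_nhds hc2pos))
  obtain ⟨q, hqdef⟩ : ∃ q : ℝ, q = 1 / (L * η) := ⟨_, rfl⟩
  have hq : 4 ≤ q := by
    rw [hqdef, le_div_iff₀ (by positivity)]
    rw [le_div_iff₀ (by positivity)] at hη'
    linarith
  have hqp : 0 < q := by linarith
  have hLq : L * η * q = 1 := by rw [hqdef]; field_simp
  have hT0p : (0 : ℝ) < T0 + 1 := by positivity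
  obtain ⟨δ, hδ, hδ1, hδ2, hδ3⟩ : ∃ δ : ℝ, 0 < δ ∧ δ ≤ δ' ∧ δ ≤ c1 / 100 ∧
      δ ≤ 1 / (5 * (T0 + 1)) :=
    ⟨min δ' (min (c1 / 100) (1 / (5 * (T0 + 1)))), by positivity, min_le_left _ _,
      (min_le_right _ _).trans (min_le_left _ _), (min_le_right _ _).trans (min_le_right _ _)⟩
  have hantiη : Antitone Fη := by
    intro u v huv
    rw [hscale, hscale]
    exact hanti1 (mul_le_mul_of_nonneg_left huv hη.le)
  have hηdiv : ∀ s : ℝ, η * (s * q) = s / L := by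
    intro s; rw [hqdef]; field_simp
  obtain ⟨T, hT1, hTl, hTb⟩ := core_s6 Fη q δ c1 c2 c3 hq hδ hδ2 hc1le hc3p hc3h
    (fun e => (hFη e).1.1) (fun e => (hFη e).1.2) hantiη
    (by rw [hscale, mul_zero, hstd1])
    (by
      intro s hs
      rw [hscale]
      have h1 := hstd4 (η * -s) 0
      rw [hstd1, sub_zero, mul_neg, abs_neg, abs_of_nonneg (mul_nonneg hη.le hs)] at h1
      have h2 : L * (η * s) = s / q := by rw [hqdef]; field_simp
      rw [h2] at h1
      rw [mul_neg]
      linarith [le_abs_self (F1 (-(η * s)) - 1 / 2)])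
    (by
      have : Fη = fun e => F1 (η * e) := funext hscale
      rw [this]
      exact hstd2.comp (tendsto_id.const_mul_atBot hη))
    (by
      rw [hscale, hc1]
      have : η * (q / 20) = 1 / (20 * L) := by rw [hqdef]; field_simp
      rw [this]; ring)
    (by
      intro E hE
      rw [hscale] at hE ⊢
      have h1 := hmain1 δ hδ hδ1 _ hE
      have : η * (E - c1 ^ 2 * q / (30 * δ)) = η * E - c1 ^ 2 / (30 * L * δ) := by
        rw [hqdef]; field_simp
      rw [this]; exact h1)
    (by
      intro E hE
      rw [hscale] at hE ⊢
      have h1 := hmain2 δ hδ hδ1 _ hE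
      refine h1.trans (hanti1 ?_)
      have e1 : η * (E - c3 * c1 ^ 2 * q / 120 + δ) =
          η * E - c3 * c1 ^ 2 / (120 * L) + η * δ := by
        rw [hqdef]; field_simp
      have e2 : η * δ ≤ δ / (4 * L) := by
        have := mul_le_mul_of_nonneg_right hη' hδ.le
        rw [div_mul_eq_mul_div, one_mul] at this
        exact this
      rw [e1]; linarith)
    (hardA Fη δ) (hardB Fη δ) (fun t => (hardState Fη δ t).2.1)
    (fun t => (hardState Fη δ t).2.2.2) (fun t => (hardState Fη δ t).1)
    (fun t => (hardState Fη δ t).2.2.1)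
    rfl rfl rfl rfl (fun t => rfl) (fun t => rfl) (fun t => rfl) (fun t => rfl)
    (fun t => rfl) (fun t => rfl)
  have hTT0 : T0 ≤ T := by
    have h1 : (T0 : ℝ) + 1 ≤ q / (20 * δ) := by
      rw [le_div_iff₀ (by positivity)]
      rw [le_div_iff₀ (by positivity)] at hδ3
      linarith
    have : (T0 : ℝ) ≤ T := by linarith
    exact_mod_cast this
  have hbound := hf (hardGame δ) (by
    intro i j
    fin_cases i <;> fin_cases j <;> simp [hardGame] <;> first | (constructor <;> linarith) | norm_num)
    _ _ (hard_oftrl Fη δ) T hT1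
  have hg := hard_gap δ (hardA Fη δ T) (hardB Fη δ T) (hFη _).1.2
  have hlt := hT0 T hTT0
  have : c2 ≤ f T := by
    refine le_trans ?_ hbound
    refine le_trans ?_ hg
    linarith
  linarith

end
end
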